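/- For all γ,δ>0 there exist Δ₀ and C>0 such that for every finite graph G=(V,E) with maximum degree Δ≥Δ₀ and girth at least 6, every 0<λ<(1−δ)·λ_c(Δ), and every v∈V: if X is distributed according to the hard-core Gibbs distribution μ, then with probability at least 1 − exp(−Δ/C) it holds that |R(X,v) − ∏_{z∈N(v)} (1 − (λ/(1+λ))·R(X,z))| < γ. -/

import Mathlib

open scoped BigOperators

attribute [local instance] Classical.propDecidable

noncomputable section

namespace HardCore

/-- The critical fugacity `λ_c(Δ) = (Δ-1)^(Δ-1) / (Δ-2)^Δ`. -/
def lambdaC (D : ℕ) : ℝ := ((D : ℝ) - 1) ^ (D - 1) / ((D : ℝ) - 2) ^ D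

variable {V : Type} [Fintype V] [DecidableEq V]

/-- `s` is an independent set of `G`. -/
def IsIndep (G : SimpleGraph V) (s : Finset V) : Prop :=
  ∀ u ∈ s, ∀ w ∈ s, ¬ G.Adj u w

/-- hard-core weight `λ^|σ|` of an independent set (0 for non-independent sets). -/
def weight (G : SimpleGraph V) (lam : ℝ) (s : Finset V) : ℝ :=
  if IsIndep G s then lam ^ s.card else 0

/-- The hard-core Gibbs distribution `μ(σ) = λ^|σ| / Z`. -/
def gibbs (G : SimpleGraph V) (lam : ℝ) (s : Finset V) : ℝ :=
  weight G lam s / ∑ t : Finset V, weight G lam t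

/-- Probability of an event under the Gibbs distribution. -/
def gibbsProb (G : SimpleGraph V) (lam : ℝ) (A : Set (Finset V)) : ℝ :=
  ∑ s : Finset V, if s ∈ A then gibbs G lam s else 0

/-- `U_{v,p}(σ)`: indicator that `σ ∩ (N(v) \ {p}) = ∅`. -/
def unblockedInd (G : SimpleGraph V) [DecidableRel G.Adj] (σ : Finset V) (v p : V) : ℝ :=
  if σ ∩ ((G.neighborFinset v).erase p) = ∅ then 1 else 0

/-- `R(σ,v) = ∏_{z ∈ N(v)} (1 - (λ/(1+λ))·U_{z,v}(σ))`. -/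
def Rfun (G : SimpleGraph V) [DecidableRel G.Adj] (lam : ℝ) (σ : Finset V) (v : V) : ℝ :=
  ∏ z ∈ G.neighborFinset v, (1 - lam / (1 + lam) * unblockedInd G σ z v)

end HardCore

open HardCore

namespace HardCore

lemma odds_mem_Icc {lam : ℝ} (hlam : 0 < lam) : lam / (1 + lam) ∈ Set.Icc (0 : ℝ) 1 :=
  ⟨by positivity, by rw [div_le_one (by positivity)]; linarith⟩

lemma one_sub_mul_mem_Icc {x y : ℝ} (hx : x ∈ Set.Icc (0 : ℝ) 1) (hy : y ∈ Set.Icc (0 : ℝ) 1) :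
    1 - x * y ∈ Set.Icc (0 : ℝ) 1 :=
  ⟨by nlinarith [hx.1, hx.2, hy.1, hy.2], by nlinarith [hx.1, hx.2, hy.1, hy.2]⟩

lemma prod_mem_Icc {ι : Type*} (s : Finset ι) {f : ι → ℝ} (hf : ∀ i ∈ s, f i ∈ Set.Icc (0 : ℝ) 1) :
    ∏ i ∈ s, f i ∈ Set.Icc (0 : ℝ) 1 :=
  ⟨Finset.prod_nonneg fun i hi => (hf i hi).1,
    Finset.prod_le_one (fun i hi => (hf i hi).1) fun i hi => (hf i hi).2⟩

/-- Moment generating function bound for a centred Bernoulli variable. -/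
lemma bernoulli_mgf_le {p t : ℝ} (hp : p ∈ Set.Icc (0 : ℝ) 1) (ht : |t| ≤ 1) :
    p * Real.exp (t * (1 - p)) + (1 - p) * Real.exp (t * (0 - p)) ≤ Real.exp (t ^ 2) := by
  obtain ⟨h0, h1⟩ := hp
  have b (x : ℝ) (hx : |x| ≤ 1) : Real.exp (t * x) ≤ 1 + t * x + (t * x) ^ 2 := by
    have := abs_le.1 (Real.abs_exp_sub_one_sub_id_le (x := t * x)
      (by rw [abs_mul]; exact mul_le_one₀ ht (abs_nonneg _) hx))
    linarith [this.2]
  have b1 := b (1 - p) (abs_le.2 ⟨by linarith, by linarith⟩)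
  have b2 := b (0 - p) (abs_le.2 ⟨by linarith, by linarith⟩)
  have b3 : p * (1 - p) ≤ 1 := by nlinarith
  calc _ ≤ p * (1 + t * (1 - p) + (t * (1 - p)) ^ 2)
          + (1 - p) * (1 + t * (0 - p) + (t * (0 - p)) ^ 2) :=
        add_le_add (mul_le_mul_of_nonneg_left b1 h0)
          (mul_le_mul_of_nonneg_left b2 (by linarith))
    _ = t ^ 2 * (p * (1 - p)) + 1 := by ring
    _ ≤ t ^ 2 + 1 := by nlinarith [sq_nonneg t]
    _ ≤ _ := Real.add_one_le_exp _

lemma abs_prod_sub_prod_le {ι : Type*} (s : Finset ι) {f g : ι → ℝ}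
    (hf : ∀ i ∈ s, f i ∈ Set.Icc (0 : ℝ) 1) (hg : ∀ i ∈ s, g i ∈ Set.Icc (0 : ℝ) 1) :
    |∏ i ∈ s, f i - ∏ i ∈ s, g i| ≤ ∑ i ∈ s, |f i - g i| := by
  classical
  induction s using Finset.induction_on with
  | empty => simp
  | insert a s ha ih =>
    have hf' : ∀ i ∈ s, f i ∈ Set.Icc (0 : ℝ) 1 := fun i hi => hf i (by simp [hi])
    have hg' : ∀ i ∈ s, g i ∈ Set.Icc (0 : ℝ) 1 := fun i hi => hg i (by simp [hi])
    have hfa := hf a (by simp)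
    have hgp := prod_mem_Icc s hg'
    rw [Finset.prod_insert ha, Finset.prod_insert ha, Finset.sum_insert ha]
    calc |f a * ∏ i ∈ s, f i - g a * ∏ i ∈ s, g i|
        = |(f a - g a) * ∏ i ∈ s, g i + f a * (∏ i ∈ s, f i - ∏ i ∈ s, g i)| := by ring_nf
      _ ≤ |f a - g a| * |∏ i ∈ s, g i| + |f a| * |∏ i ∈ s, f i - ∏ i ∈ s, g i| := by
          rw [← abs_mul, ← abs_mul]; exact abs_add_le _ _
      _ ≤ |f a - g a| * 1 + 1 * ∑ i ∈ s, |f i - g i| := by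
          rw [abs_of_nonneg hgp.1, abs_of_nonneg hfa.1]
          exact add_le_add (mul_le_mul_of_nonneg_left hgp.2 (abs_nonneg _))
            (mul_le_mul hfa.2 (ih hf' hg') (abs_nonneg _) zero_le_one)
      _ = _ := by ring

lemma abs_prod_one_sub_sub_exp_le {ι : Type*} (s : Finset ι) {x : ι → ℝ}
    (hx : ∀ i ∈ s, x i ∈ Set.Icc (0 : ℝ) 1) :
    |∏ i ∈ s, (1 - x i) - Real.exp (-∑ i ∈ s, x i)| ≤ ∑ i ∈ s, x i ^ 2 := by
  rw [← Finset.sum_neg_distrib, Real.exp_sum]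
  refine (abs_prod_sub_prod_le s (fun i hi => ?_) fun i hi => ?_).trans
    (Finset.sum_le_sum fun i hi => ?_)
  · exact ⟨by linarith [(hx i hi).2], by linarith [(hx i hi).1]⟩
  · exact ⟨(Real.exp_pos _).le, Real.exp_le_one_iff.2 (by linarith [(hx i hi).1])⟩
  · have := Real.abs_exp_sub_one_sub_id_le (x := -x i)
      (by rw [abs_neg, abs_of_nonneg (hx i hi).1]; exact (hx i hi).2)
    rw [neg_sq] at this
    rwa [abs_sub_comm, show Real.exp (-x i) - (1 - x i) = Real.exp (-x i) - 1 - -x i by ring]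

lemma abs_exp_neg_sub_exp_neg_le {x y : ℝ} (hx : 0 ≤ x) (hy : 0 ≤ y) :
    |Real.exp (-x) - Real.exp (-y)| ≤ |x - y| := by
  wlog h : x ≤ y generalizing x y
  · rw [abs_sub_comm, abs_sub_comm x]
    exact this hy hx (le_of_not_ge h)
  rw [abs_of_nonneg (sub_nonneg.2 (Real.exp_le_exp.2 (by linarith))), abs_of_nonpos (by linarith)]
  have h1 : Real.exp (-y) = Real.exp (-x) * Real.exp (-(y - x)) := by
    rw [← Real.exp_add]; ring_nf
  have h2 := Real.add_one_le_exp (-(y - x))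
  have h3 : Real.exp (-x) ≤ 1 := Real.exp_le_one_iff.2 (by linarith)
  have h4 := Real.exp_pos (-x)
  rw [h1]
  nlinarith

lemma abs_prod_one_sub_mul_sub_le {ι : Type*} (s : Finset ι) {w : ℝ} {a b : ι → ℝ}
    (hw : w ∈ Set.Icc (0 : ℝ) 1) (ha : ∀ i ∈ s, a i ∈ Set.Icc (0 : ℝ) 1)
    (hb : ∀ i ∈ s, b i ∈ Set.Icc (0 : ℝ) 1) :
    |∏ i ∈ s, (1 - w * a i) - ∏ i ∈ s, (1 - w * b i)|
      ≤ 2 * (s.card * w ^ 2) + w * |∑ i ∈ s, (a i - b i)| := by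
  have mem {c : ι → ℝ} (hc : ∀ i ∈ s, c i ∈ Set.Icc (0 : ℝ) 1) :
      ∀ i ∈ s, w * c i ∈ Set.Icc (0 : ℝ) 1 := fun i hi =>
    ⟨mul_nonneg hw.1 (hc i hi).1, mul_le_one₀ hw.2 (hc i hi).1 (hc i hi).2⟩
  have bound {c : ι → ℝ} (hc : ∀ i ∈ s, c i ∈ Set.Icc (0 : ℝ) 1) :
      |∏ i ∈ s, (1 - w * c i) - Real.exp (-∑ i ∈ s, w * c i)| ≤ s.card * w ^ 2 := by
    refine (abs_prod_one_sub_sub_exp_le s (mem hc)).trans ?_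
    rw [← nsmul_eq_mul]
    refine Finset.sum_le_card_nsmul _ _ _ fun i hi => ?_
    exact pow_le_pow_left₀ (mem hc i hi).1 (mul_le_of_le_one_right hw.1 (hc i hi).2) 2
  have h1 := bound ha
  have h2 := bound hb
  have h3 := abs_exp_neg_sub_exp_neg_le (Finset.sum_nonneg fun i hi => (mem ha i hi).1)
    (Finset.sum_nonneg fun i hi => (mem hb i hi).1)
  have h4 : |∑ i ∈ s, w * a i - ∑ i ∈ s, w * b i| = w * |∑ i ∈ s, (a i - b i)| := by
    rw [← Finset.sum_sub_distrib, ← abs_of_nonneg hw.1, ← abs_mul, Finset.mul_sum,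
      abs_of_nonneg hw.1]
    simp only [mul_sub]
  rw [h4] at h3
  rw [abs_le] at *
  constructor <;> linarith [h1.1, h1.2, h2.1, h2.2, h3.1, h3.2]

lemma lambdaC_mul_le {D : ℕ} (hD : 4 ≤ D) : lambdaC D * D ≤ 16 := by
  obtain ⟨n, rfl⟩ := Nat.exists_eq_add_of_le' hD
  have hn : (0 : ℝ) ≤ n := n.cast_nonneg
  have e1 : ((n + 4 : ℕ) : ℝ) - 1 = (n + 2) * (1 + 1 / (n + 2)) := by
    push_cast; field_simp; ring
  have e2 : ((n + 4 : ℕ) : ℝ) - 2 = n + 2 := by push_cast; ring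
  have h1 : (1 + 1 / ((n : ℝ) + 2)) ^ (n + 3) ≤ 8 := by
    calc (1 + 1 / ((n : ℝ) + 2)) ^ (n + 3) ≤ Real.exp (1 / (n + 2)) ^ (n + 3) := by
          gcongr
          linarith [Real.add_one_le_exp (1 / ((n : ℝ) + 2))]
      _ = Real.exp ((n + 3 : ℕ) * (1 / (n + 2))) := (Real.exp_nat_mul _ _).symm
      _ ≤ Real.exp (2 : ℕ) := by
          refine Real.exp_le_exp.2 ?_
          rw [mul_one_div, div_le_iff₀ (by positivity)]
          push_cast
          linarith
      _ = Real.exp 1 ^ 2 := by rw [← Real.exp_nat_mul]; norm_num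
      _ ≤ 2.7182818286 ^ 2 := by gcongr; exact Real.exp_one_lt_d9.le
      _ ≤ 8 := by norm_num
  have h2 : ((n + 4 : ℕ) : ℝ) ≤ 2 * (n + 2) := by push_cast; linarith
  have h3 : lambdaC (n + 4) = (1 + 1 / ((n : ℝ) + 2)) ^ (n + 3) / (n + 2) := by
    rw [lambdaC, e1, e2, mul_pow, show n + 4 - 1 = n + 3 by omega, pow_succ _ (n + 3)]
    field_simp
  rw [h3, div_mul_eq_mul_div, div_le_iff₀ (by positivity)]
  calc _ ≤ 8 * (2 * ((n : ℝ) + 2)) := by gcongr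
    _ = _ := by ring

lemma weight_nonneg {V : Type} (G : SimpleGraph V) {lam : ℝ} (hlam : 0 ≤ lam) (s : Finset V) :
    0 ≤ weight G lam s := by
  unfold weight; split_ifs <;> positivity

section Resampling

variable {V : Type} [DecidableEq V]

/-- Indicator that `σ` does not meet `T`. -/
def vacantInd (σ T : Finset V) : ℝ := if Disjoint σ T then 1 else 0

lemma vacantInd_eq_zero_or_one (σ T : Finset V) : vacantInd σ T = 0 ∨ vacantInd σ T = 1 := by
  unfold vacantInd; split_ifs <;> simp

lemma vacantInd_nonneg (σ T : Finset V) : 0 ≤ vacantInd σ T := by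
  rcases vacantInd_eq_zero_or_one σ T with h | h <;> simp [h]

lemma vacantInd_le_one (σ T : Finset V) : vacantInd σ T ≤ 1 := by
  rcases vacantInd_eq_zero_or_one σ T with h | h <;> simp [h]

lemma vacantInd_mem_Icc (σ T : Finset V) : vacantInd σ T ∈ Set.Icc (0 : ℝ) 1 :=
  ⟨vacantInd_nonneg σ T, vacantInd_le_one σ T⟩

lemma vacantInd_insert_left {a : V} {T : Finset V} (ha : a ∉ T) (σ : Finset V) :
    vacantInd (insert a σ) T = vacantInd σ T := by
  simp [vacantInd, Finset.disjoint_insert_left, ha]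

lemma vacantInd_insert_right (a : V) (σ T : Finset V) :
    vacantInd σ (insert a T) = vacantInd σ {a} * vacantInd σ T := by
  by_cases ha : a ∈ σ <;> simp [vacantInd, Finset.disjoint_insert_right, ha]

variable [Fintype V] (G : SimpleGraph V) [DecidableRel G.Adj]

lemma unblockedInd_eq_vacantInd (σ : Finset V) (v p : V) :
    unblockedInd G σ v p = vacantInd σ ((G.neighborFinset v).erase p) := by
  simp [unblockedInd, vacantInd, Finset.disjoint_iff_inter_eq_empty]

lemma weight_insert (lam : ℝ) {a : V} {s : Finset V} (ha : a ∉ s) :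
    weight G lam (insert a s) = lam * vacantInd s (G.neighborFinset a) * weight G lam s := by
  have key : IsIndep G (insert a s) ↔ Disjoint s (G.neighborFinset a) ∧ IsIndep G s := by
    rw [Finset.disjoint_left]
    constructor
    · intro h
      refine ⟨fun u hu hua => ?_, fun u hu w hw => ?_⟩
      · exact h a (by simp) u (by simp [hu]) (by simpa using hua)
      · exact h u (by simp [hu]) w (by simp [hw])
    · rintro ⟨h1, h2⟩ u hu w hw huw
      rw [Finset.mem_insert] at hu hw
      rcases hu with rfl | hu <;> rcases hw with rfl | hw
      · exact G.loopless.irrefl _ huw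
      · exact h1 hw (by simpa using huw)
      · exact h1 hu (by simpa using huw.symm)
      · exact h2 u hu w hw huw
  unfold weight vacantInd
  by_cases h1 : Disjoint s (G.neighborFinset a) <;> by_cases h2 : IsIndep G s <;>
    simp [key, h1, h2, ha, pow_succ, mul_comm]

lemma sum_finset_eq_sum_erase (a : V) (f : Finset V → ℝ) :
    ∑ s : Finset V, f s
      = ∑ s ∈ ((Finset.univ : Finset V).erase a).powerset, (f s + f (insert a s)) := by
  rw [← Finset.powerset_univ, ← Finset.insert_erase (Finset.mem_univ a),
    Finset.sum_powerset_insert (by simp), Finset.sum_add_distrib]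
  simp

/-- Resampling a single vertex. -/
lemma sum_weight_vacant_vertex {lam : ℝ} (hlam : 0 < lam) (a : V) (F : Finset V → ℝ)
    (hF : ∀ σ, F (insert a σ) = F σ) :
    ∑ σ, weight G lam σ * (F σ * vacantInd σ {a})
      = ∑ σ, weight G lam σ *
          (F σ * (1 - lam / (1 + lam) * vacantInd σ (G.neighborFinset a))) := by
  rw [sum_finset_eq_sum_erase a, sum_finset_eq_sum_erase a]
  refine Finset.sum_congr rfl fun s hs => ?_
  have ha : a ∉ s := fun h => by simpa using Finset.mem_powerset.1 hs h
  have h1 : vacantInd s {a} = 1 := by simp [vacantInd, ha]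
  have h2 : vacantInd (insert a s) {a} = 0 := by simp [vacantInd]
  rw [weight_insert G lam ha, hF, h1, h2,
    vacantInd_insert_left (T := G.neighborFinset a) (by simp)]
  have : 1 + lam ≠ 0 := by positivity
  rcases vacantInd_eq_zero_or_one s (G.neighborFinset a) with h | h <;> rw [h]
  · ring
  · field_simp
    ring

/-- Conditional probability that `T` is vacant given the configuration outside `T`, when no two
vertices of `T` are adjacent. -/
def vacantProb (lam : ℝ) (σ T : Finset V) : ℝ :=
  ∏ a ∈ T, (1 - lam / (1 + lam) * vacantInd σ (G.neighborFinset a))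

lemma vacantProb_insert {lam : ℝ} {b : V} {T : Finset V} (h : ∀ a ∈ T, ¬ G.Adj a b)
    (σ : Finset V) : vacantProb G lam (insert b σ) T = vacantProb G lam σ T := by
  refine Finset.prod_congr rfl fun a ha => ?_
  rw [vacantInd_insert_left (by simpa using h a ha)]

/-- Resampling an independent set of vertices. -/
lemma sum_weight_vacant {lam : ℝ} (hlam : 0 < lam) (T : Finset V)
    (hT : ∀ a ∈ T, ∀ b ∈ T, ¬ G.Adj a b) (F : Finset V → ℝ)
    (hF : ∀ a ∈ T, ∀ σ, F (insert a σ) = F σ) :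
    ∑ σ, weight G lam σ * (F σ * vacantInd σ T)
      = ∑ σ, weight G lam σ * (F σ * vacantProb G lam σ T) := by
  induction T using Finset.induction_on generalizing F with
  | empty => simp [vacantInd, vacantProb]
  | insert a T ha ih =>
    have h1 := ih (fun x hx y hy => hT x (by simp [hx]) y (by simp [hy]))
      (fun σ => F σ * vacantInd σ {a}) (fun x hx σ => by
        rw [hF x (by simp [hx]), vacantInd_insert_left]
        rintro h
        exact ha (Finset.mem_singleton.1 h ▸ hx))
    have h2 := sum_weight_vacant_vertex G hlam a (fun σ => F σ * vacantProb G lam σ T)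
      (fun σ => by
        rw [hF a (by simp), vacantProb_insert G fun x hx => hT x (by simp [hx]) a (by simp)])
    calc _ = ∑ σ, weight G lam σ * (F σ * vacantInd σ {a} * vacantInd σ T) := by
          simp only [vacantInd_insert_right, mul_assoc]
      _ = _ := h1
      _ = ∑ σ, weight G lam σ * (F σ * vacantProb G lam σ T * vacantInd σ {a}) := by
          refine Finset.sum_congr rfl fun σ _ => by ring
      _ = _ := h2
      _ = _ := by
          refine Finset.sum_congr rfl fun σ _ => ?_
          rw [vacantProb, vacantProb, Finset.prod_insert ha]
          ring

lemma vacantProb_mem_Icc {lam : ℝ} (hlam : 0 < lam) (σ T : Finset V) :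
    vacantProb G lam σ T ∈ Set.Icc (0 : ℝ) 1 :=
  prod_mem_Icc _ fun _ _ => one_sub_mul_mem_Icc (odds_mem_Icc hlam) (vacantInd_mem_Icc _ _)

lemma Rfun_mem_Icc {lam : ℝ} (hlam : 0 < lam) (σ : Finset V) (v : V) :
    Rfun G lam σ v ∈ Set.Icc (0 : ℝ) 1 :=
  prod_mem_Icc _ fun _ _ => by
    rw [unblockedInd_eq_vacantInd]
    exact one_sub_mul_mem_Icc (odds_mem_Icc hlam) (vacantInd_mem_Icc _ _)

/-- Exponential moments of `∑ z ∈ S, (vacantInd σ (T z) - vacantProb G lam σ (T z))`. -/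
lemma sum_weight_exp_vacant_le {ι : Type*} {lam t : ℝ} (hlam : 0 < lam) (ht : |t| ≤ 1)
    (S : Finset ι) (T : ι → Finset V)
    (hdisj : ∀ i ∈ S, ∀ j ∈ S, i ≠ j → Disjoint (T i) (T j))
    (hadj : ∀ i ∈ S, ∀ j ∈ S, ∀ a ∈ T i, ∀ b ∈ T j, ¬ G.Adj a b) :
    ∑ σ, weight G lam σ *
        Real.exp (t * ∑ z ∈ S, (vacantInd σ (T z) - vacantProb G lam σ (T z)))
      ≤ Real.exp (t ^ 2 * S.card) * ∑ σ, weight G lam σ := by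
  classical
  induction S using Finset.induction_on with
  | empty => simp
  | insert i S hi ih =>
    have ih' := ih (fun x hx y hy => hdisj x (by simp [hx]) y (by simp [hy]))
      (fun x hx y hy => hadj x (by simp [hx]) y (by simp [hy]))
    set Y : Finset V → ℝ := fun σ =>
      ∑ z ∈ S, (vacantInd σ (T z) - vacantProb G lam σ (T z)) with hY
    set p : Finset V → ℝ := fun σ => vacantProb G lam σ (T i) with hp
    have hTi := hadj i (by simp) i (by simp)
    have hYi : ∀ a ∈ T i, ∀ σ, Y (insert a σ) = Y σ := by
      intro a ha σ
      refine Finset.sum_congr rfl fun z hz => ?_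
      have hne : i ≠ z := fun h => hi (h ▸ hz)
      rw [vacantInd_insert_left
          (Finset.disjoint_left.1 (hdisj i (by simp) z (by simp [hz]) hne) ha),
        vacantProb_insert G fun x hx => hadj z (by simp [hz]) i (by simp) x hx a ha]
    have hpi : ∀ a ∈ T i, ∀ σ, p (insert a σ) = p σ := fun a ha σ =>
      vacantProb_insert G (fun x hx => hTi x hx a ha) σ
    have key := sum_weight_vacant G hlam (T i) hTi
      (fun σ => Real.exp (t * Y σ) *
        (Real.exp (t * (1 - p σ)) - Real.exp (t * (0 - p σ))))
      (fun a ha σ => by rw [hYi a ha, hpi a ha])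
    have split (σ : Finset V) :
        Real.exp (t * ∑ z ∈ insert i S, (vacantInd σ (T z) - vacantProb G lam σ (T z)))
          = Real.exp (t * Y σ) * (Real.exp (t * (1 - p σ)) - Real.exp (t * (0 - p σ))) *
              vacantInd σ (T i) + Real.exp (t * Y σ) * Real.exp (t * (0 - p σ)) := by
      rw [Finset.sum_insert hi, mul_add, Real.exp_add]
      rcases vacantInd_eq_zero_or_one σ (T i) with h | h <;> rw [h] <;> simp only [hY, hp] <;> ring
    calc _ = ∑ σ, weight G lam σ *
            (Real.exp (t * Y σ) * (Real.exp (t * (1 - p σ)) - Real.exp (t * (0 - p σ))) *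
              vacantInd σ (T i)) +
          ∑ σ, weight G lam σ * (Real.exp (t * Y σ) * Real.exp (t * (0 - p σ))) := by
          rw [← Finset.sum_add_distrib]
          refine Finset.sum_congr rfl fun σ _ => by rw [split, mul_add]
      _ = ∑ σ, weight G lam σ * (Real.exp (t * Y σ) *
            (p σ * Real.exp (t * (1 - p σ)) + (1 - p σ) * Real.exp (t * (0 - p σ)))) := by
          rw [key, ← Finset.sum_add_distrib]
          refine Finset.sum_congr rfl fun σ _ => ?_
          simp only [hp]
          ring
      _ ≤ ∑ σ, weight G lam σ * (Real.exp (t * Y σ) * Real.exp (t ^ 2)) := by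
          refine Finset.sum_le_sum fun σ _ => ?_
          have := bernoulli_mgf_le (vacantProb_mem_Icc G hlam σ (T i)) ht
          have hw := weight_nonneg G hlam.le σ
          gcongr
      _ = Real.exp (t ^ 2) * ∑ σ, weight G lam σ * Real.exp (t * Y σ) := by
          rw [Finset.mul_sum]
          refine Finset.sum_congr rfl fun σ _ => by ring
      _ ≤ Real.exp (t ^ 2) * (Real.exp (t ^ 2 * S.card) * ∑ σ, weight G lam σ) := by gcongr
      _ = _ := by
          rw [← mul_assoc, ← Real.exp_add, Finset.card_insert_of_notMem hi]
          push_cast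
          ring_nf

/-- Exponential moment of the number of occupied vertices in `S`. -/
lemma sum_weight_exp_card_le {lam : ℝ} (hlam : 0 < lam) (S : Finset V) :
    ∑ σ, weight G lam σ * Real.exp (∑ z ∈ S, (1 - vacantInd σ {z}))
      ≤ Real.exp (2 * lam * S.card) * ∑ σ, weight G lam σ := by
  induction S using Finset.induction_on with
  | empty => simp
  | insert i S hi ih =>
    set Y : Finset V → ℝ := fun σ => ∑ z ∈ S, (1 - vacantInd σ {z}) with hY
    have hYi : ∀ σ, Y (insert i σ) = Y σ := by
      intro σ
      refine Finset.sum_congr rfl fun z hz => ?_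
      rw [vacantInd_insert_left]
      rw [Finset.mem_singleton]
      exact fun h => hi (h ▸ hz)
    have key := sum_weight_vacant_vertex G hlam i
      (fun σ => Real.exp (Y σ) * (1 - Real.exp 1)) (fun σ => by rw [hYi])
    have split (σ : Finset V) :
        Real.exp (∑ z ∈ insert i S, (1 - vacantInd σ {z}))
          = Real.exp (Y σ) * (1 - Real.exp 1) * vacantInd σ {i} +
            Real.exp (Y σ) * Real.exp 1 := by
      rw [Finset.sum_insert hi, Real.exp_add]
      rcases vacantInd_eq_zero_or_one σ {i} with h | h <;> rw [h] <;> simp [hY] <;> ring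
    calc _ = ∑ σ, weight G lam σ * (Real.exp (Y σ) * (1 - Real.exp 1) * vacantInd σ {i}) +
          ∑ σ, weight G lam σ * (Real.exp (Y σ) * Real.exp 1) := by
          rw [← Finset.sum_add_distrib]
          refine Finset.sum_congr rfl fun σ _ => by rw [split, mul_add]
      _ = ∑ σ, weight G lam σ * (Real.exp (Y σ) * (1 + (Real.exp 1 - 1) *
            (lam / (1 + lam) * vacantInd σ (G.neighborFinset i)))) := by
          rw [key, ← Finset.sum_add_distrib]
          refine Finset.sum_congr rfl fun σ _ => by ring
      _ ≤ ∑ σ, weight G lam σ * (Real.exp (Y σ) * Real.exp (2 * lam)) := by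
          refine Finset.sum_le_sum fun σ _ => ?_
          have hw := weight_nonneg G hlam.le σ
          have h1 : lam / (1 + lam) * vacantInd σ (G.neighborFinset i) ≤ lam :=
            (mul_le_of_le_one_right (by positivity) (vacantInd_le_one _ _)).trans
              (div_le_self hlam.le (by linarith))
          have h2 : 1 + (Real.exp 1 - 1) *
              (lam / (1 + lam) * vacantInd σ (G.neighborFinset i)) ≤ Real.exp (2 * lam) := by
            have := Real.add_one_le_exp (2 * lam)
            have := Real.exp_one_lt_d9
            have := Real.add_one_le_exp 1
            have := mul_le_mul (a := Real.exp 1 - 1) (b := 2) (by linarith) h1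
              (mul_nonneg (by positivity) (vacantInd_nonneg _ _)) (by norm_num)
            linarith
          gcongr
      _ = Real.exp (2 * lam) * ∑ σ, weight G lam σ * Real.exp (Y σ) := by
          rw [Finset.mul_sum]
          refine Finset.sum_congr rfl fun σ _ => by ring
      _ ≤ Real.exp (2 * lam) * (Real.exp (2 * lam * S.card) * ∑ σ, weight G lam σ) := by gcongr
      _ = _ := by
          rw [← mul_assoc, ← Real.exp_add, Finset.card_insert_of_notMem hi]
          push_cast
          ring_nf

end Resampling

lemma sum_weight_pos {V : Type} [Fintype V] (G : SimpleGraph V) {lam : ℝ} (hlam : 0 ≤ lam) :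
    0 < ∑ σ, weight G lam σ := by
  refine Finset.sum_pos' (fun σ _ => weight_nonneg G hlam σ) ⟨∅, Finset.mem_univ _, ?_⟩
  simp [weight, IsIndep]

/-- A first-moment bound on the failure probability of an event. -/
lemma one_sub_le_gibbsProb {V : Type} [Fintype V] (G : SimpleGraph V) {lam c : ℝ} (hlam : 0 ≤ lam)
    (A : Set (Finset V)) (f : Finset V → ℝ) (hf : ∀ σ, 0 ≤ f σ) (hA : ∀ σ ∉ A, 1 ≤ f σ)
    (hc : ∑ σ, weight G lam σ * f σ ≤ c * ∑ σ, weight G lam σ) :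
    1 - c ≤ gibbsProb G lam A := by
  have hZ := sum_weight_pos G hlam
  have h : gibbsProb G lam A
      = (∑ σ, if σ ∈ A then weight G lam σ else 0) / ∑ σ, weight G lam σ := by
    rw [gibbsProb, Finset.sum_div]
    refine Finset.sum_congr rfl fun σ _ => ?_
    split_ifs <;> simp [gibbs]
  rw [h, le_div_iff₀ hZ, sub_mul, one_mul, sub_le_iff_le_add]
  refine le_trans ?_ (add_le_add_right hc _)
  rw [← Finset.sum_add_distrib]
  refine Finset.sum_le_sum fun σ _ => ?_
  have hw := weight_nonneg G hlam σ
  split_ifs with hσ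
  · linarith [mul_nonneg hw (hf σ)]
  · linarith [mul_le_mul_of_nonneg_left (hA σ hσ) hw]

section Girth

variable {V : Type} {G : SimpleGraph V}

lemma not_triangle (hg : 6 ≤ G.egirth) {a b c : V} (h1 : G.Adj a b) (h2 : G.Adj b c)
    (h3 : G.Adj c a) : False := by
  have := SimpleGraph.le_egirth.1 hg a (.cons h1 (.cons h2 (.cons h3 .nil)))
    (by simp [SimpleGraph.Walk.cons_isCycle_iff, h1.ne, h2.ne, h3.ne, h1.ne', h3.ne'])
  norm_num at this

lemma not_four_cycle (hg : 6 ≤ G.egirth) {a b c d : V} (h1 : G.Adj a b) (h2 : G.Adj b c)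
    (h3 : G.Adj c d) (h4 : G.Adj d a) (hac : a ≠ c) (hbd : b ≠ d) : False := by
  have := SimpleGraph.le_egirth.1 hg a (.cons h1 (.cons h2 (.cons h3 (.cons h4 .nil))))
    (by simp [SimpleGraph.Walk.cons_isCycle_iff, h1.ne, h2.ne, h3.ne, h4.ne, h1.ne', h4.ne',
      hac, hac.symm, hbd])
  norm_num at this

lemma not_five_cycle (hg : 6 ≤ G.egirth) {a b c d e : V} (h1 : G.Adj a b) (h2 : G.Adj b c)
    (h3 : G.Adj c d) (h4 : G.Adj d e) (h5 : G.Adj e a) (hac : a ≠ c) (had : a ≠ d) (hbd : b ≠ d)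
    (hbe : b ≠ e) (hce : c ≠ e) : False := by
  have := SimpleGraph.le_egirth.1 hg a
    (.cons h1 (.cons h2 (.cons h3 (.cons h4 (.cons h5 .nil)))))
    (by simp [SimpleGraph.Walk.cons_isCycle_iff, h1.ne, h2.ne, h3.ne, h4.ne, h5.ne, h1.ne',
      h5.ne', hac, hac.symm, hbd, had, had.symm, hbe, hce])
  norm_num at this

variable [Fintype V] [DecidableEq V] [DecidableRel G.Adj]

lemma disjoint_children (hg : 6 ≤ G.egirth) (v : V) :
    ∀ y ∈ G.neighborFinset v, ∀ z ∈ G.neighborFinset v, y ≠ z →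
      Disjoint ((G.neighborFinset y).erase v) ((G.neighborFinset z).erase v) := by
  intro y hy z hz hyz
  rw [Finset.disjoint_left]
  intro w hw hw'
  simp only [Finset.mem_erase, SimpleGraph.mem_neighborFinset] at hy hz hw hw'
  exact not_four_cycle hg hy hw.2 hw'.2.symm hz.symm (Ne.symm hw.1) hyz

lemma not_adj_children (hg : 6 ≤ G.egirth) (v : V) :
    ∀ y ∈ G.neighborFinset v, ∀ z ∈ G.neighborFinset v, ∀ a ∈ (G.neighborFinset y).erase v,
      ∀ b ∈ (G.neighborFinset z).erase v, ¬ G.Adj a b := by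
  intro y hy z hz a ha b hb hab
  simp only [Finset.mem_erase, SimpleGraph.mem_neighborFinset] at hy hz ha hb
  by_cases hyz : y = z
  · subst hyz
    exact not_triangle hg ha.2 hab hb.2.symm
  by_cases haz : a = z
  · subst haz
    exact not_triangle hg hy ha.2 hz.symm
  by_cases hby : b = y
  · subst hby
    exact not_triangle hg hz hb.2 hy.symm
  exact not_five_cycle hg hy ha.2 hab hb.2.symm hz.symm (Ne.symm ha.1) (Ne.symm hb.1)
    (Ne.symm hby) hyz haz

end Girth

section Recurrence

variable {V : Type} [Fintype V] [DecidableEq V] (G : SimpleGraph V) [DecidableRel G.Adj]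

lemma abs_Rfun_sub_vacantProb_le {lam : ℝ} (hlam : 0 < lam) (σ : Finset V) {v z : V}
    (hz : z ∈ G.neighborFinset v) :
    |vacantProb G lam σ ((G.neighborFinset z).erase v) - Rfun G lam σ z|
      ≤ lam / (1 + lam) + (1 - vacantInd σ {z}) := by
  have hR := Rfun_mem_Icc G hlam σ z
  have hP := vacantProb_mem_Icc G hlam σ ((G.neighborFinset z).erase v)
  have hw := odds_mem_Icc hlam
  by_cases hσ : z ∈ σ
  · have : vacantInd σ {z} = 0 := by simp [vacantInd, hσ]
    rw [this, abs_le]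
    constructor <;> linarith [hR.1, hR.2, hP.1, hP.2, hw.1]
  · have h1 : vacantInd σ {z} = 1 := by simp [vacantInd, hσ]
    have hv : v ∈ G.neighborFinset z := by simpa [SimpleGraph.adj_comm] using hz
    have h2 : Rfun G lam σ z
        = (1 - lam / (1 + lam) * vacantInd σ ((G.neighborFinset v).erase z)) *
          vacantProb G lam σ ((G.neighborFinset z).erase v) := by
      rw [Rfun, ← Finset.mul_prod_erase _ _ hv, unblockedInd_eq_vacantInd]
      congr 1
      refine Finset.prod_congr rfl fun w hw => ?_
      have hzw : z ∈ G.neighborFinset w := by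
        simpa [SimpleGraph.adj_comm] using Finset.mem_of_mem_erase hw
      rw [unblockedInd_eq_vacantInd]
      conv_rhs => rw [← Finset.insert_erase hzw, vacantInd_insert_right, h1, one_mul]
    have hu := vacantInd_mem_Icc σ ((G.neighborFinset v).erase z)
    have h3 : vacantProb G lam σ ((G.neighborFinset z).erase v) - Rfun G lam σ z
        = lam / (1 + lam) * (vacantInd σ ((G.neighborFinset v).erase z) *
          vacantProb G lam σ ((G.neighborFinset z).erase v)) := by
      rw [h2]; ring
    rw [h3, h1, sub_self, add_zero,
      abs_of_nonneg (mul_nonneg hw.1 (mul_nonneg hu.1 hP.1))]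
    exact mul_le_of_le_one_right hw.1 (mul_le_one₀ hu.2 hP.1 hP.2)

/-- The recurrence error in terms of the fluctuation of the number of unblocked neighbours and the
number of occupied neighbours. -/
lemma abs_Rfun_sub_prod_le {lam : ℝ} (hlam : 0 < lam) (σ : Finset V) (v : V) :
    |Rfun G lam σ v - ∏ z ∈ G.neighborFinset v, (1 - lam / (1 + lam) * Rfun G lam σ z)|
      ≤ 3 * (G.degree v * lam ^ 2) + lam *
        (|∑ z ∈ G.neighborFinset v, (vacantInd σ ((G.neighborFinset z).erase v) -
            vacantProb G lam σ ((G.neighborFinset z).erase v))| +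
          ∑ z ∈ G.neighborFinset v, (1 - vacantInd σ {z})) := by
  have hw := odds_mem_Icc hlam
  have hwl : lam / (1 + lam) ≤ lam := div_le_self hlam.le (by linarith)
  have h1 := abs_prod_one_sub_mul_sub_le (G.neighborFinset v) hw
    (a := fun z => vacantInd σ ((G.neighborFinset z).erase v)) (b := fun z => Rfun G lam σ z)
    (fun z _ => vacantInd_mem_Icc _ _) (fun z _ => Rfun_mem_Icc G hlam σ z)
  rw [SimpleGraph.card_neighborFinset_eq_degree] at h1
  have h2 : |∑ z ∈ G.neighborFinset v,
      (vacantInd σ ((G.neighborFinset z).erase v) - Rfun G lam σ z)|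
      ≤ |∑ z ∈ G.neighborFinset v, (vacantInd σ ((G.neighborFinset z).erase v) -
            vacantProb G lam σ ((G.neighborFinset z).erase v))| +
        (G.degree v * lam + ∑ z ∈ G.neighborFinset v, (1 - vacantInd σ {z})) := by
    calc _ = |∑ z ∈ G.neighborFinset v, (vacantInd σ ((G.neighborFinset z).erase v) -
            vacantProb G lam σ ((G.neighborFinset z).erase v)) +
          ∑ z ∈ G.neighborFinset v,
            (vacantProb G lam σ ((G.neighborFinset z).erase v) - Rfun G lam σ z)| := by
          rw [← Finset.sum_add_distrib]
          simp only [sub_add_sub_cancel]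
      _ ≤ _ := abs_add_le _ _
      _ ≤ _ := by
          gcongr
          refine (Finset.abs_sum_le_sum_abs _ _).trans ((Finset.sum_le_sum fun z hz =>
            (abs_Rfun_sub_vacantProb_le G hlam σ hz).trans (add_le_add_left hwl _)).trans ?_)
          rw [Finset.sum_add_distrib, Finset.sum_const, nsmul_eq_mul,
            SimpleGraph.card_neighborFinset_eq_degree]
  have h3 : Rfun G lam σ v = ∏ z ∈ G.neighborFinset v,
      (1 - lam / (1 + lam) * vacantInd σ ((G.neighborFinset z).erase v)) := by
    simp only [Rfun, unblockedInd_eq_vacantInd]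
  rw [h3]
  have h4 : (lam / (1 + lam)) ^ 2 ≤ lam ^ 2 := pow_le_pow_left₀ hw.1 hwl 2
  have h5 := mul_le_mul hwl h2 (abs_nonneg _) hlam.le
  have h6 := mul_le_mul_of_nonneg_left h4 (Nat.cast_nonneg (α := ℝ) (G.degree v))
  linarith

/-- Markov's inequality for the exponential moments of the three bad events. -/
lemma gibbsProb_good_ge {lam ε : ℝ} {D : ℕ} (hg : 6 ≤ G.egirth) (hlam : 0 < lam) (hε : 0 < ε)
    (hε1 : ε ≤ 1) (v : V) (hD : G.degree v ≤ D) (hlD : lam * D ≤ 16) (A : Set (Finset V))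
    (hA : ∀ σ,
      |∑ z ∈ G.neighborFinset v, (vacantInd σ ((G.neighborFinset z).erase v) -
            vacantProb G lam σ ((G.neighborFinset z).erase v))| ≤ ε * D →
      ∑ z ∈ G.neighborFinset v, (1 - vacantInd σ {z}) ≤ ε * D → σ ∈ A) :
    1 - Real.exp (33 - ε ^ 2 / 4 * D) ≤ gibbsProb G lam A := by
  set Y : Finset V → ℝ := fun σ => ∑ z ∈ G.neighborFinset v,
    (vacantInd σ ((G.neighborFinset z).erase v) -
      vacantProb G lam σ ((G.neighborFinset z).erase v)) with hY
  set N : Finset V → ℝ := fun σ => ∑ z ∈ G.neighborFinset v, (1 - vacantInd σ {z}) with hN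
  have hdD : (G.degree v : ℝ) ≤ D := by exact_mod_cast hD
  have hZ := (sum_weight_pos G hlam.le).le
  have hYm (t : ℝ) (ht : |t| = ε / 2) :
      ∑ σ, weight G lam σ * Real.exp (t * Y σ)
        ≤ Real.exp (ε ^ 2 / 4 * D) * ∑ σ, weight G lam σ := by
    refine (sum_weight_exp_vacant_le G hlam (by rw [ht]; linarith) (G.neighborFinset v) _
      (disjoint_children hg v) (not_adj_children hg v)).trans ?_
    rw [SimpleGraph.card_neighborFinset_eq_degree, ← sq_abs, ht]
    gcongr
    nlinarith [sq_nonneg ε]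
  have h1 := hYm (ε / 2) (abs_of_nonneg (by linarith))
  have h2 := hYm (-(ε / 2)) (by rw [abs_neg, abs_of_nonneg (by linarith)])
  have h3 : ∑ σ, weight G lam σ * Real.exp (N σ) ≤ Real.exp 32 * ∑ σ, weight G lam σ := by
    refine (sum_weight_exp_card_le G hlam (G.neighborFinset v)).trans ?_
    rw [SimpleGraph.card_neighborFinset_eq_degree]
    gcongr
    nlinarith
  refine one_sub_le_gibbsProb G hlam.le A (fun σ =>
    Real.exp (-(ε ^ 2 / 2 * D)) * Real.exp (ε / 2 * Y σ) +
      Real.exp (-(ε ^ 2 / 2 * D)) * Real.exp (-(ε / 2) * Y σ) +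
      Real.exp (-(ε * D)) * Real.exp (N σ)) (fun σ => by positivity) (fun σ hσ => ?_) ?_
  · have p1 := Real.exp_pos (-(ε ^ 2 / 2 * D) + ε / 2 * Y σ)
    have p2 := Real.exp_pos (-(ε ^ 2 / 2 * D) + -(ε / 2) * Y σ)
    have p3 := Real.exp_pos (-(ε * D) + N σ)
    simp only [← Real.exp_add]
    by_cases hNσ : N σ ≤ ε * D
    · have hYσ : ε * D < |Y σ| := lt_of_not_ge fun h => hσ (hA σ h hNσ)
      rcases lt_abs.1 hYσ with h | h
      · have := Real.one_le_exp (x := -(ε ^ 2 / 2 * D) + ε / 2 * Y σ) (by nlinarith)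
        linarith
      · have := Real.one_le_exp (x := -(ε ^ 2 / 2 * D) + -(ε / 2) * Y σ) (by nlinarith)
        linarith
    · have := Real.one_le_exp (x := -(ε * D) + N σ) (by linarith)
      linarith
  · have e1 : Real.exp (-(ε ^ 2 / 2 * D)) * Real.exp (ε ^ 2 / 4 * D)
        = Real.exp (-(ε ^ 2 / 4 * D)) := by
      rw [← Real.exp_add]; ring_nf
    have e2 : Real.exp (-(ε * D)) ≤ Real.exp (-(ε ^ 2 / 4 * D)) := by
      refine Real.exp_le_exp.2 (neg_le_neg (mul_le_mul_of_nonneg_right ?_ D.cast_nonneg))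
      nlinarith
    have e3 : 2 + Real.exp 32 ≤ Real.exp 33 := by
      have a := Real.add_one_le_exp (32 : ℝ)
      have b := Real.add_one_le_exp (1 : ℝ)
      have : Real.exp 33 = Real.exp 32 * Real.exp 1 := by rw [← Real.exp_add]; norm_num
      rw [this]
      nlinarith
    have hN0 : 0 ≤ ∑ σ, weight G lam σ * Real.exp (N σ) :=
      Finset.sum_nonneg fun σ _ => mul_nonneg (weight_nonneg G hlam.le σ) (Real.exp_pos _).le
    calc _ = Real.exp (-(ε ^ 2 / 2 * D)) * ∑ σ, weight G lam σ * Real.exp (ε / 2 * Y σ) +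
          Real.exp (-(ε ^ 2 / 2 * D)) * ∑ σ, weight G lam σ * Real.exp (-(ε / 2) * Y σ) +
          Real.exp (-(ε * D)) * ∑ σ, weight G lam σ * Real.exp (N σ) := by
          simp only [Finset.mul_sum, ← Finset.sum_add_distrib]
          refine Finset.sum_congr rfl fun σ _ => by ring
      _ ≤ Real.exp (-(ε ^ 2 / 2 * D)) * (Real.exp (ε ^ 2 / 4 * D) * ∑ σ, weight G lam σ) +
          Real.exp (-(ε ^ 2 / 2 * D)) * (Real.exp (ε ^ 2 / 4 * D) * ∑ σ, weight G lam σ) +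
          Real.exp (-(ε ^ 2 / 4 * D)) * (Real.exp 32 * ∑ σ, weight G lam σ) := by
          exact add_le_add (by gcongr) (mul_le_mul e2 h3 hN0 (Real.exp_pos _).le)
      _ = (2 + Real.exp 32) * (Real.exp (-(ε ^ 2 / 4 * D)) * ∑ σ, weight G lam σ) := by
          rw [← mul_assoc, e1]; ring
      _ ≤ Real.exp 33 * (Real.exp (-(ε ^ 2 / 4 * D)) * ∑ σ, weight G lam σ) := by gcongr
      _ = _ := by rw [← mul_assoc, ← Real.exp_add, sub_eq_add_neg]

end Recurrence

end HardCore

theorem R_approximate_recurrence :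
    ∀ γ δ : ℝ, 0 < γ → 0 < δ →
    ∃ (Δ₀ : ℕ) (C : ℝ), 0 < C ∧
      ∀ (V : Type) [Fintype V] [DecidableEq V] (G : SimpleGraph V) [DecidableRel G.Adj]
        (Δ : ℕ) (lam : ℝ),
        G.maxDegree = Δ → Δ₀ ≤ Δ → 6 ≤ G.egirth →
        0 < lam → lam < (1 - δ) * lambdaC Δ →
        ∀ v : V,
          gibbsProb G lam
              {σ : Finset V |
                |Rfun G lam σ v -
                    ∏ z ∈ G.neighborFinset v, (1 - lam / (1 + lam) * Rfun G lam σ z)| < γ}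
            ≥ 1 - Real.exp (-(Δ : ℝ) / C) := by
  intro γ δ hγ hδ
  set ε : ℝ := min 1 (γ / 64) with hε
  have hε0 : 0 < ε := lt_min one_pos (by positivity)
  have hε1 : ε ≤ 1 := min_le_left _ _
  have hεγ : ε ≤ γ / 64 := min_le_right _ _
  refine ⟨⌈1536 / γ⌉₊ + ⌈264 / ε ^ 2⌉₊ + 5, 8 / ε ^ 2, by positivity, ?_⟩
  intro V _ _ G _ Δ lam hΔ hΔ₀ hg hlam hlam' v
  have hΔ1 : 1536 / γ < Δ := by
    refine (Nat.le_ceil _).trans_lt ?_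
    exact_mod_cast (by omega : ⌈1536 / γ⌉₊ < Δ)
  have hΔ2 : 264 / ε ^ 2 ≤ Δ := (Nat.le_ceil _).trans (by
    exact_mod_cast (by omega : ⌈264 / ε ^ 2⌉₊ ≤ Δ))
  have hΔ4 : 4 ≤ Δ := by omega
  have hΔpos : (0 : ℝ) < Δ := by exact_mod_cast (by omega : 0 < Δ)
  have hlC : 0 ≤ lambdaC Δ := by
    have : (4 : ℝ) ≤ Δ := by exact_mod_cast hΔ4
    exact div_nonneg (pow_nonneg (by linarith) _) (pow_nonneg (by linarith) _)
  have hlD : lam * Δ ≤ 16 :=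
    (mul_le_mul_of_nonneg_right (by nlinarith) hΔpos.le).trans (lambdaC_mul_le hΔ4)
  have hdeg : G.degree v ≤ Δ := hΔ ▸ G.degree_le_maxDegree v
  have hdeg' : (G.degree v : ℝ) ≤ Δ := by exact_mod_cast hdeg
  have hexp : 33 - ε ^ 2 / 4 * Δ ≤ -(Δ : ℝ) / (8 / ε ^ 2) := by
    rw [div_le_iff₀ (by positivity)] at hΔ2
    have : -(Δ : ℝ) / (8 / ε ^ 2) = -(Δ * ε ^ 2 / 8) := by field_simp
    rw [this]
    linarith
  refine ge_iff_le.2 ((sub_le_sub_left (Real.exp_le_exp.2 hexp) 1).trans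
    (gibbsProb_good_ge G hg hlam hε0 hε1 v hdeg hlD _ fun σ hY hN => ?_))
  refine (abs_Rfun_sub_prod_le G hlam σ v).trans_lt ?_
  have hlam16 : lam ≤ 16 / Δ := by rwa [le_div_iff₀ hΔpos]
  have h1 : (G.degree v : ℝ) * lam ^ 2 ≤ 256 / Δ := by
    calc (G.degree v : ℝ) * lam ^ 2 ≤ (Δ : ℝ) * (16 / Δ) ^ 2 := by gcongr
      _ = 256 / (Δ : ℝ) := by field_simp; norm_num
  have h2 := mul_le_mul_of_nonneg_left (add_le_add hY hN) hlam.le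
  have h3 : 768 / (Δ : ℝ) < γ / 2 := by
    rw [div_lt_iff₀ hγ] at hΔ1
    rw [div_lt_iff₀ hΔpos]
    linarith
  have h4 : lam * (ε * Δ + ε * Δ) ≤ γ / 2 := by nlinarith
  have h5 : 3 * (256 / (Δ : ℝ)) = 768 / Δ := by ring
  linarith
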